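/- For any two-qubit density matrix ρ with concurrence C(ρ), the maximal CHSH expectation satisfies β(ρ) ≤ √(1 + C(ρ)²). -/

import Mathlib

open Matrix Kronecker BigOperators ComplexOrder

noncomputable section

/-- The Pauli matrices σ₁ (x), σ₂ (y), σ₃ (z), indexed by `Fin 3`. -/
def pauli : Fin 3 → Matrix (Fin 2) (Fin 2) ℂ
  | 0 => !![0, 1; 1, 0]
  | 1 => !![0, -Complex.I; Complex.I, 0]
  | 2 => !![1, 0; 0, -1]

/-- A unit vector in ℝ³. -/
def unitVec (v : Fin 3 → ℝ) : Prop := ∑ i, v i ^ 2 = 1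

/-- The CHSH Bell operator associated to measurement directions a, b, c, d. -/
def bellOp (a b c d : Fin 3 → ℝ) : Matrix (Fin 2 × Fin 2) (Fin 2 × Fin 2) ℂ :=
  (1 / 2 : ℂ) • ∑ i, ∑ j,
    ((a i * (c j + d j) + b i * (c j - d j) : ℝ) : ℂ) • (pauli i ⊗ₖ pauli j)

/-- The set of CHSH expectation values of a two-qubit state. -/
def betaSet (ρ : Matrix (Fin 2 × Fin 2) (Fin 2 × Fin 2) ℂ) : Set ℝ :=
  {t : ℝ | ∃ a b c d : Fin 3 → ℝ, unitVec a ∧ unitVec b ∧ unitVec c ∧ unitVec d ∧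
    t = (Matrix.trace (ρ * bellOp a b c d)).re}

/-- The correlation matrix R_{kl} = tr(ρ σ_k ⊗ σ_l). -/
def corr (ρ : Matrix (Fin 2 × Fin 2) (Fin 2 × Fin 2) ℂ) : Matrix (Fin 3) (Fin 3) ℝ :=
  Matrix.of fun k l => (Matrix.trace (ρ * (pauli k ⊗ₖ pauli l))).re

/-- The four Bell states. -/
def bell : Fin 4 → (Fin 2 × Fin 2) → ℂ
  | 0 => fun p => if p = (0, 0) then (Real.sqrt 2 : ℂ)⁻¹ else if p = (1, 1) then (Real.sqrt 2 : ℂ)⁻¹ else 0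
  | 1 => fun p => if p = (0, 0) then (Real.sqrt 2 : ℂ)⁻¹ else if p = (1, 1) then -(Real.sqrt 2 : ℂ)⁻¹ else 0
  | 2 => fun p => if p = (0, 1) then (Real.sqrt 2 : ℂ)⁻¹ else if p = (1, 0) then (Real.sqrt 2 : ℂ)⁻¹ else 0
  | 3 => fun p => if p = (0, 1) then (Real.sqrt 2 : ℂ)⁻¹ else if p = (1, 0) then -(Real.sqrt 2 : ℂ)⁻¹ else 0

/-- Projector onto the i-th Bell state. -/
def bellProj (i : Fin 4) : Matrix (Fin 2 × Fin 2) (Fin 2 × Fin 2) ℂ :=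
  Matrix.vecMulVec (bell i) (star (bell i))

section Takagi

variable {E : Type*} [NormedAddCommGroup E] [InnerProductSpace ℂ E]

/-- A self-adjoint antilinear map has a unit eigenvector with nonnegative eigenvalue. -/
theorem exists_unit_eigenvector_of_antilinear [FiniteDimensional ℂ E] [Nontrivial E]
    (T : E →ₗ⋆[ℂ] E) (hT : ∀ x y, inner ℂ (T x) y = inner ℂ (T y) x) :
    ∃ x : E, ‖x‖ = 1 ∧ ∃ r : ℝ, 0 ≤ r ∧ T x = (r : ℂ) • x := by
  let : InnerProductSpace ℝ E := InnerProductSpace.complexToReal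
  let S : E →ₗ[ℝ] E :=
    { toFun := T
      map_add' := T.map_add
      map_smul' := fun r x => by
        have := T.map_smulₛₗ (r : ℂ) x
        simpa using this }
  have hS : S.IsSymmetric := fun x y => by
    change (inner ℂ (T x) y).re = (inner ℂ x (T y)).re
    rw [hT, ← inner_conj_symm x (T y), Complex.conj_re]
  obtain ⟨v, hv⟩ := hS.hasEigenvalue_iSup_of_finiteDimensional.exists_hasEigenvector
  obtain ⟨r, hr⟩ : ∃ r : ℝ, T v = (r : ℂ) • v := ⟨_, by simpa [S] using hv.apply_eq_smul⟩
  have hne : (‖v‖ : ℂ) ≠ 0 := by simpa using hv.2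
  have hnorm : ‖((‖v‖ : ℂ)⁻¹) • v‖ = 1 := by
    rw [norm_smul, norm_inv, Complex.norm_real, norm_norm]
    exact inv_mul_cancel₀ (by exact_mod_cast hne)
  have heig : T (((‖v‖ : ℂ)⁻¹) • v) = (r : ℂ) • (((‖v‖ : ℂ)⁻¹) • v) := by
    rw [T.map_smulₛₗ, hr, smul_comm]
    simp
  rcases le_total 0 r with h | h
  · exact ⟨_, hnorm, r, h, heig⟩
  · refine ⟨Complex.I • (((‖v‖ : ℂ)⁻¹) • v), by rw [norm_smul, hnorm]; simp, -r, by linarith, ?_⟩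
    rw [T.map_smulₛₗ, heig, smul_comm]
    simp

/-- A self-adjoint antilinear map has orthonormal families of eigenvectors with nonnegative
eigenvalues, up to the dimension of the space. -/
theorem exists_orthonormal_eigenvectors_of_antilinear [FiniteDimensional ℂ E]
    (T : E →ₗ⋆[ℂ] E) (hT : ∀ x y, inner ℂ (T x) y = inner ℂ (T y) x) (k : ℕ)
    (hk : k ≤ Module.finrank ℂ E) :
    ∃ b : Fin k → E, Orthonormal ℂ b ∧ ∃ r : Fin k → ℝ, (∀ i, 0 ≤ r i) ∧
      ∀ i, T (b i) = (r i : ℂ) • b i := by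
  induction k with
  | zero => exact ⟨![], by simp [Orthonormal, Pairwise], ![], by simp, by simp⟩
  | succ k ih =>
    obtain ⟨b, hb, r, hr, hTb⟩ := ih (by omega)
    let W := (Submodule.span ℂ (Set.range b))ᗮ
    have hmem : ∀ {y}, y ∈ W ↔ ∀ i, inner ℂ (b i) y = 0 := fun {y} => by
      rw [← Submodule.span_singleton_le_iff_mem, ← Submodule.le_orthogonal_iff_le_orthogonal,
        Submodule.span_le, Set.range_subset_iff]
      refine forall_congr' fun i => ?_
      rw [SetLike.mem_coe, Submodule.mem_orthogonal_singleton_iff_inner_left]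
    have hW : ∀ y ∈ W, T y ∈ W := fun y hy => hmem.2 fun i => by
      rw [← inner_conj_symm, hT, hTb, inner_smul_left, hmem.1 hy i]
      simp
    have : Nontrivial W := by
      have h1 := Submodule.finrank_add_finrank_orthogonal (Submodule.span ℂ (Set.range b))
      rw [finrank_span_eq_card hb.linearIndependent, Fintype.card_fin] at h1
      have h2 : 0 < Module.finrank ℂ W := by
        change 0 < Module.finrank ℂ (Submodule.span ℂ (Set.range b))ᗮ
        omega
      exact Module.nontrivial_of_finrank_pos h2
    let TW : W →ₗ⋆[ℂ] W := (T.domRestrict W).codRestrict W fun y => hW y y.2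
    obtain ⟨x, hx, s, hs, hTx⟩ := exists_unit_eigenvector_of_antilinear TW
      fun x y => hT (x : E) (y : E)
    refine ⟨Matrix.vecCons (x : E) b, orthonormal_vecCons_iff.2 ⟨hx, fun i => ?_, hb⟩,
      Matrix.vecCons s r, fun i => ?_, fun i => ?_⟩
    · rw [← inner_conj_symm, hmem.1 x.2 i, map_zero]
    · refine Fin.cases ?_ (fun i => ?_) i
      · simpa using hs
      · simpa using hr i
    · refine Fin.cases ?_ (fun i => ?_) i
      · exact congrArg Subtype.val hTx
      · simpa using hTb i

end Takagi

/-- **Takagi factorization** of a complex symmetric matrix. -/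
theorem Matrix.exists_takagi {n : ℕ} (A : Matrix (Fin n) (Fin n) ℂ) (hA : Aᵀ = A) :
    ∃ U : Matrix (Fin n) (Fin n) ℂ, Uᴴ * U = 1 ∧ ∃ r : Fin n → ℝ, (∀ i, 0 ≤ r i) ∧
      Uᵀ * A * U = diagonal fun i => (r i : ℂ) := by
  let T : EuclideanSpace ℂ (Fin n) →ₗ⋆[ℂ] EuclideanSpace ℂ (Fin n) :=
    { toFun := fun x => WithLp.toLp 2 (star (A *ᵥ x.ofLp))
      map_add' := fun x y => by simp [mulVec_add]
      map_smul' := fun c x => by simp [mulVec_smul] }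
  have hin : ∀ x y, inner ℂ (T x) y = y.ofLp ⬝ᵥ A *ᵥ x.ofLp := fun x y => by
    simp [T, EuclideanSpace.inner_eq_star_dotProduct]
  obtain ⟨b, hb, r, hr, hTb⟩ := exists_orthonormal_eigenvectors_of_antilinear T
    (fun x y => by
      rw [hin, hin, dotProduct_mulVec, ← mulVec_transpose, hA, dotProduct_comm]) n (by simp)
  have hval : ∀ i j, b i ⬝ᵥ A *ᵥ b j = (r j : ℂ) * if j = i then 1 else 0 := fun i j => by
    rw [← hin, hTb, inner_smul_left, orthonormal_iff_ite.1 hb]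
    simp
  refine ⟨Matrix.of fun i j => b j i, ?_, r, hr, ?_⟩
  · ext i j
    have := orthonormal_iff_ite.1 hb i j
    rw [EuclideanSpace.inner_eq_star_dotProduct, dotProduct_comm] at this
    simpa [Matrix.mul_apply, Matrix.one_apply, dotProduct] using this
  · ext i j
    rw [Matrix.mul_assoc]
    have := hval i j
    simp only [Matrix.mul_apply, dotProduct, mulVec] at this ⊢
    simp only [transpose_apply, of_apply, this, diagonal_apply]
    by_cases h : i = j
    · simp [h]
    · simp [h, Ne.symm h]

/-- Half of the Hadamard matrix of order four. -/
def hadamardFour : Matrix (Fin 4) (Fin 4) ℝ :=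
  !![1/2, 1/2, 1/2, 1/2; 1/2, -1/2, 1/2, -1/2; 1/2, 1/2, -1/2, -1/2; 1/2, -1/2, -1/2, 1/2]

theorem hadamardFour_mul_transpose : hadamardFour * hadamardFourᵀ = 1 := by
  ext i j
  fin_cases i <;> fin_cases j <;>
    simp [hadamardFour, Matrix.mul_apply, Fin.sum_univ_four] <;> norm_num

theorem hadamardFour_sq (i j : Fin 4) : hadamardFour i j * hadamardFour i j = 1 / 4 := by
  fin_cases i <;> fin_cases j <;> norm_num [hadamardFour]

/-- A real symmetric traceless matrix of order four is orthogonally equivalent to a matrix with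
zero diagonal. -/
theorem exists_orthogonal_diag_eq_zero (S : Matrix (Fin 4) (Fin 4) ℝ) (hS : S.IsHermitian)
    (htr : S.trace = 0) :
    ∃ O : Matrix (Fin 4) (Fin 4) ℝ, O * Oᵀ = 1 ∧ ∀ k, (Oᵀ * S * O) k k = 0 := by
  let Q : Matrix (Fin 4) (Fin 4) ℝ := hS.eigenvectorUnitary
  have hQ : Q * Qᵀ = 1 := by
    simpa [Q, star_eq_conjTranspose] using (Unitary.mem_iff.1 hS.eigenvectorUnitary.2).2
  have hQ' : Qᵀ * Q = 1 := mul_eq_one_comm.1 hQ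
  have hdiag : Qᵀ * S * Q = diagonal hS.eigenvalues := by
    have h := hS.spectral_theorem
    rw [Unitary.conjStarAlgAut_apply] at h
    have h' : S = Q * diagonal hS.eigenvalues * Qᵀ := by
      simpa [Q, star_eq_conjTranspose, Function.comp_def] using h
    conv_lhs => rw [h']
    calc Qᵀ * (Q * diagonal hS.eigenvalues * Qᵀ) * Q
        = (Qᵀ * Q) * diagonal hS.eigenvalues * (Qᵀ * Q) := by simp only [Matrix.mul_assoc]
      _ = _ := by rw [hQ', Matrix.one_mul, Matrix.mul_one]
  have hsum : ∑ i, hS.eigenvalues i = 0 := by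
    have := hS.trace_eq_sum_eigenvalues
    rw [htr] at this
    simpa using this.symm
  refine ⟨Q * hadamardFour, ?_, fun k => ?_⟩
  · calc Q * hadamardFour * (Q * hadamardFour)ᵀ
        = Q * (hadamardFour * hadamardFourᵀ) * Qᵀ := by
          simp only [transpose_mul, Matrix.mul_assoc]
      _ = 1 := by rw [hadamardFour_mul_transpose, Matrix.mul_one, hQ]
  · have : (Q * hadamardFour)ᵀ * S * (Q * hadamardFour)
        = hadamardFourᵀ * diagonal hS.eigenvalues * hadamardFour := by
      rw [← hdiag]
      simp only [transpose_mul, Matrix.mul_assoc]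
    rw [this, Matrix.mul_apply]
    calc ∑ j, (hadamardFourᵀ * diagonal hS.eigenvalues) k j * hadamardFour j k
        = ∑ j, hS.eigenvalues j * (1 / 4) := by
          refine Finset.sum_congr rfl fun j _ => ?_
          rw [mul_diagonal, transpose_apply, ← hadamardFour_sq j k]
          ring
      _ = 0 := by rw [← Finset.sum_mul, hsum, zero_mul]

/-- Three lengths obeying the triangle inequalities are the sides of a triangle in the complex
plane. -/
theorem exists_unit_add_eq {a b r : ℝ} (ha : 0 ≤ a) (hb : 0 ≤ b) (hr : 0 ≤ r)
    (h1 : a ≤ b + r) (h2 : b ≤ a + r) (h3 : r ≤ a + b) :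
    ∃ u v : ℂ, ‖u‖ = 1 ∧ ‖v‖ = 1 ∧ u * a + v * b = r := by
  have hm : ∀ u : ℂ, ‖u‖ = 1 ↔ u.re ^ 2 + u.im ^ 2 = 1 := fun u => by
    rw [← Complex.sq_norm_sub_sq_re]
    constructor
    · intro h; rw [h]; ring
    · intro h
      have : ‖u‖ ^ 2 = 1 := by linarith
      nlinarith [norm_nonneg u]
  rcases ha.eq_or_lt with rfl | ha
  · obtain rfl : b = r := by linarith
    exact ⟨1, 1, by simp, by simp, by simp⟩
  rcases hb.eq_or_lt with rfl | hb
  · obtain rfl : a = r := by linarith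
    exact ⟨1, 1, by simp, by simp, by simp⟩
  rcases hr.eq_or_lt with rfl | hr
  · obtain rfl : a = b := by linarith
    exact ⟨1, -1, by simp, by simp, by simp⟩
  let x := (a ^ 2 + r ^ 2 - b ^ 2) / (2 * r)
  have hx : 2 * r * x = a ^ 2 + r ^ 2 - b ^ 2 := by simp only [x]; field_simp
  have hxa : x ^ 2 ≤ a ^ 2 := by
    have e : (2 * r) ^ 2 * (a ^ 2 - x ^ 2)
        = ((b + r - a) * (a + b - r)) * ((a + r - b) * (a + b + r)) := by
      have : (2 * r) ^ 2 * x ^ 2 = (a ^ 2 + r ^ 2 - b ^ 2) ^ 2 := by rw [← hx]; ring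
      linear_combination -this
    have h0 : 0 ≤ (2 * r) ^ 2 * (a ^ 2 - x ^ 2) := by
      rw [e]
      refine mul_nonneg (mul_nonneg ?_ ?_) (mul_nonneg ?_ ?_) <;> linarith
    have := nonneg_of_mul_nonneg_right h0 (by positivity)
    linarith
  let y := Real.sqrt (a ^ 2 - x ^ 2)
  have hy : y ^ 2 = a ^ 2 - x ^ 2 := Real.sq_sqrt (by linarith)
  refine ⟨⟨x / a, y / a⟩, ⟨(r - x) / b, -y / b⟩, (hm _).2 ?_, (hm _).2 ?_, ?_⟩
  · simp only [div_pow, hy]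
    field_simp
    ring
  · simp only [div_pow, neg_sq, hy]
    field_simp
    linear_combination -hx
  · apply Complex.ext
    · simp [ha.ne', hb.ne']
    · simp [ha.ne', hb.ne']

/-- Four ordered lengths, the largest being at most the sum of the others, are the sides of a
quadrilateral in the complex plane. -/
theorem exists_unit_sum_mul_eq_zero (r : Fin 4 → ℝ) (h0 : 0 ≤ r 3) (h1 : r 3 ≤ r 2)
    (h2 : r 2 ≤ r 1) (h3 : r 1 ≤ r 0) (h : r 0 ≤ r 1 + r 2 + r 3) :
    ∃ u : Fin 4 → ℂ, (∀ i, ‖u i‖ = 1) ∧ ∑ i, u i * r i = 0 := by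
  let s := max (r 0 - r 1) (r 2 - r 3)
  have hs1 : r 0 - r 1 ≤ s := le_max_left _ _
  have hs2 : r 2 - r 3 ≤ s := le_max_right _ _
  have hs3 : s ≤ r 2 + r 3 := max_le (by linarith) (by linarith)
  have hs4 : s ≤ r 0 + r 1 := max_le (by linarith) (by linarith)
  obtain ⟨u0, u1, hu0, hu1, e1⟩ := exists_unit_add_eq (a := r 0) (b := r 1) (r := s)
    (by linarith) (by linarith) (by linarith) (by linarith) (by linarith) (by linarith)
  obtain ⟨u2, u3, hu2, hu3, e2⟩ := exists_unit_add_eq (a := r 2) (b := r 3) (r := s)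
    (by linarith) (by linarith) (by linarith) (by linarith) (by linarith) (by linarith)
  refine ⟨![u0, u1, -u2, -u3], ?_, ?_⟩
  · intro i; fin_cases i <;> simp [hu0, hu1, hu2, hu3]
  · simp [Fin.sum_univ_four]
    linear_combination e1 - e2

/-- The expectation of `σ i ⊗ σ j` in the vector `w`. -/
def corrVec (w : Fin 2 × Fin 2 → ℂ) (i j : Fin 3) : ℝ :=
  (star w ⬝ᵥ (pauli i ⊗ₖ pauli j) *ᵥ w).re

/-- The expectation of `1 ⊗ σ j` in the vector `w`. -/
def blochVec (w : Fin 2 × Fin 2 → ℂ) (j : Fin 3) : ℝ :=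
  (star w ⬝ᵥ ((1 : Matrix (Fin 2) (Fin 2) ℂ) ⊗ₖ pauli j) *ᵥ w).re

theorem sum_corrVec_mul_corrVec (w : Fin 2 × Fin 2 → ℂ) (j k : Fin 3) :
    ∑ i, corrVec w i j * corrVec w i k
      = (if j = k then ‖w ⬝ᵥ (pauli 1 ⊗ₖ pauli 1) *ᵥ w‖ ^ 2 else 0)
        + blochVec w j * blochVec w k := by
  fin_cases j <;> fin_cases k <;>
  simp [corrVec, blochVec, pauli, dotProduct, mulVec, Fintype.sum_prod_type, Fin.sum_univ_three,
    Matrix.one_apply, Complex.sq_norm, Complex.normSq_apply] <;> ring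

theorem sum_blochVec_sq (w : Fin 2 × Fin 2 → ℂ) :
    ∑ j, blochVec w j ^ 2
      = (∑ p, Complex.normSq (w p)) ^ 2 - ‖w ⬝ᵥ (pauli 1 ⊗ₖ pauli 1) *ᵥ w‖ ^ 2 := by
  simp [blochVec, pauli, dotProduct, mulVec, Fintype.sum_prod_type, Fin.sum_univ_three,
    Matrix.one_apply, Complex.sq_norm, Complex.normSq_apply]
  ring

theorem sum_mulVec_corrVec_sq (w : Fin 2 × Fin 2 → ℂ) (g : Fin 3 → ℝ) :
    (of (corrVec w) *ᵥ g) ⬝ᵥ (of (corrVec w) *ᵥ g)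
      = ‖w ⬝ᵥ (pauli 1 ⊗ₖ pauli 1) *ᵥ w‖ ^ 2 * (g ⬝ᵥ g) + (blochVec w ⬝ᵥ g) ^ 2 := by
  have h := sum_corrVec_mul_corrVec w
  generalize ‖w ⬝ᵥ (pauli 1 ⊗ₖ pauli 1) *ᵥ w‖ ^ 2 = K at h ⊢
  have h00 := h 0 0
  have h01 := h 0 1
  have h02 := h 0 2
  have h11 := h 1 1
  have h12 := h 1 2
  have h22 := h 2 2
  simp only [Fin.sum_univ_three, if_true, Fin.reduceEq, if_false] at *
  simp only [mulVec, dotProduct, of_apply, Fin.sum_univ_three]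
  linear_combination g 0 ^ 2 * h00 + g 1 ^ 2 * h11 + g 2 ^ 2 * h22 + 2 * g 0 * g 1 * h01
    + 2 * g 0 * g 2 * h02 + 2 * g 1 * g 2 * h12

theorem dotProduct_sq_le {n : Type*} [Fintype n] (x y : n → ℝ) :
    (x ⬝ᵥ y) ^ 2 ≤ (x ⬝ᵥ x) * (y ⬝ᵥ y) := by
  simpa [dotProduct, sq] using Finset.sum_mul_sq_le_sq_mul_sq Finset.univ x y

/-- Bessel's inequality for two orthogonal vectors. -/
theorem bessel_two {n : Type*} [Fintype n] (x g h : n → ℝ) (hgh : g ⬝ᵥ h = 0)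
    (hg : 0 < g ⬝ᵥ g) (hh : 0 < h ⬝ᵥ h) :
    (x ⬝ᵥ g) ^ 2 * (h ⬝ᵥ h) + (x ⬝ᵥ h) ^ 2 * (g ⬝ᵥ g) ≤ (x ⬝ᵥ x) * (g ⬝ᵥ g) * (h ⬝ᵥ h) := by
  let G := g ⬝ᵥ g
  let H := h ⬝ᵥ h
  let z := (G * H) • x - ((x ⬝ᵥ g) * H) • g - ((x ⬝ᵥ h) * G) • h
  have hz : 0 ≤ z ⬝ᵥ z := Finset.sum_nonneg fun i _ => mul_self_nonneg _
  have e : z ⬝ᵥ z = (G * H) * ((x ⬝ᵥ x) * G * H - ((x ⬝ᵥ g) ^ 2 * H + (x ⬝ᵥ h) ^ 2 * G)) := by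
    simp only [z, sub_dotProduct, dotProduct_sub, smul_dotProduct, dotProduct_smul, smul_eq_mul,
      dotProduct_comm g x, dotProduct_comm h x, dotProduct_comm h g, hgh]
    simp only [G, H]
    ring
  rw [e] at hz
  have := nonneg_of_mul_nonneg_right hz (mul_pos hg hh)
  exact sub_nonneg.1 this

theorem expectation_bellOp (w : Fin 2 × Fin 2 → ℂ) (a b c d : Fin 3 → ℝ) :
    (star w ⬝ᵥ bellOp a b c d *ᵥ w).re
      = (a ⬝ᵥ (of (corrVec w) *ᵥ (c + d)) + b ⬝ᵥ (of (corrVec w) *ᵥ (c - d))) / 2 := by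
  have h : (star w ⬝ᵥ bellOp a b c d *ᵥ w)
      = (1 / 2 : ℂ) * ∑ i, ∑ j, ((a i * (c j + d j) + b i * (c j - d j) : ℝ) : ℂ)
        * (star w ⬝ᵥ (pauli i ⊗ₖ pauli j) *ᵥ w) := by
    simp only [bellOp, smul_mulVec, dotProduct_smul, sum_mulVec, dotProduct_sum, smul_eq_mul]
  have h2 : (1 / 2 : ℂ) = ((1 / 2 : ℝ) : ℂ) := by norm_num
  rw [h, h2, Complex.re_ofReal_mul, Complex.re_sum]
  simp only [Complex.re_sum, Complex.re_ofReal_mul]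
  simp only [mulVec, dotProduct, of_apply, Fin.sum_univ_three, corrVec, Pi.add_apply,
    Pi.sub_apply]
  ring

/-- The CHSH bound for an unnormalized pure state. -/
theorem expectation_bellOp_le (w : Fin 2 × Fin 2 → ℂ) (a b c d : Fin 3 → ℝ)
    (ha : unitVec a) (hb : unitVec b) (hc : unitVec c) (hd : unitVec d) :
    (star w ⬝ᵥ bellOp a b c d *ᵥ w).re
      ≤ Real.sqrt ((∑ p, Complex.normSq (w p)) ^ 2
        + ‖w ⬝ᵥ (pauli 1 ⊗ₖ pauli 1) *ᵥ w‖ ^ 2) := by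
  apply Real.le_sqrt_of_sq_le
  have hunit : ∀ {v : Fin 3 → ℝ}, unitVec v → v ⬝ᵥ v = 1 := fun {v} hv => by
    simpa [unitVec, dotProduct, sq] using hv
  have hR : (∑ p, Complex.normSq (w p)) ^ 2
      = blochVec w ⬝ᵥ blochVec w + ‖w ⬝ᵥ (pauli 1 ⊗ₖ pauli 1) *ᵥ w‖ ^ 2 := by
    have := sum_blochVec_sq w
    simp only [dotProduct, ← sq] at this ⊢
    linarith
  rw [expectation_bellOp, hR]
  let g := c + d
  let h := c - d
  change ((a ⬝ᵥ (of (corrVec w) *ᵥ g) + b ⬝ᵥ (of (corrVec w) *ᵥ h)) / 2) ^ 2 ≤ _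
  have hgh : g ⬝ᵥ h = 0 := by
    simp only [g, h, add_dotProduct, dotProduct_sub, hunit hc, hunit hd, dotProduct_comm d c]
    ring
  have hsum : g ⬝ᵥ g + h ⬝ᵥ h = 4 := by
    simp only [g, h, add_dotProduct, dotProduct_add, sub_dotProduct, dotProduct_sub, hunit hc,
      hunit hd, dotProduct_comm d c]
    ring
  have hA := dotProduct_sq_le a (of (corrVec w) *ᵥ g)
  have hB := dotProduct_sq_le b (of (corrVec w) *ᵥ h)
  rw [hunit ha, one_mul, sum_mulVec_corrVec_sq] at hA
  rw [hunit hb, one_mul, sum_mulVec_corrVec_sq] at hB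
  have hrg := dotProduct_sq_le (blochVec w) g
  have hrh := dotProduct_sq_le (blochVec w) h
  have hbessel := bessel_two (blochVec w) g h hgh
  have hG : 0 ≤ g ⬝ᵥ g := Finset.sum_nonneg fun i _ => mul_self_nonneg _
  have hH : 0 ≤ h ⬝ᵥ h := Finset.sum_nonneg fun i _ => mul_self_nonneg _
  have hK : 0 ≤ ‖w ⬝ᵥ (pauli 1 ⊗ₖ pauli 1) *ᵥ w‖ ^ 2 := sq_nonneg _
  generalize a ⬝ᵥ (of (corrVec w) *ᵥ g) = α at *
  generalize b ⬝ᵥ (of (corrVec w) *ᵥ h) = β at *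
  generalize blochVec w ⬝ᵥ g = x at *
  generalize blochVec w ⬝ᵥ h = y at *
  generalize blochVec w ⬝ᵥ blochVec w = R at *
  generalize ‖w ⬝ᵥ (pauli 1 ⊗ₖ pauli 1) *ᵥ w‖ ^ 2 = K at *
  generalize g ⬝ᵥ g = G at *
  generalize h ⬝ᵥ h = H at *
  rcases hG.eq_or_lt with rfl | hG
  · obtain rfl : H = 4 := by linarith
    have hα : α = 0 := by nlinarith [sq_nonneg α, sq_nonneg x]
    subst hα
    nlinarith
  rcases hH.eq_or_lt with rfl | hH
  · obtain rfl : G = 4 := by linarith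
    have hβ : β = 0 := by nlinarith [sq_nonneg β, sq_nonneg y]
    subst hβ
    nlinarith
  have hb2 := hbessel hG hH
  have key : (α + β) ^ 2 * (G * H) ≤ (4 * (R + K + K)) * (G * H) := by
    have e1 : (α + β) ^ 2 * (G * H) ≤ (G + H) * (α ^ 2 * H + β ^ 2 * G) := by
      linarith [sq_nonneg (α * H - β * G)]
    have e2 := mul_le_mul_of_nonneg_right hA hH.le
    have e3 := mul_le_mul_of_nonneg_right hB hG.le
    rw [hsum] at e1
    linarith
  have := le_of_mul_le_mul_right key (mul_pos hG hH)
  linarith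

/-- Two tuples with the same multiset of values are permutations of each other. -/
theorem exists_perm_comp_eq_of_map_univ_eq {n : ℕ} {α : Type*} [LinearOrder α] {f g : Fin n → α}
    (h : Finset.univ.val.map f = Finset.univ.val.map g) :
    ∃ σ : Equiv.Perm (Fin n), f ∘ σ = g := by
  rw [Fin.univ_val_map, Fin.univ_val_map, Multiset.coe_eq_coe] at h
  have hsort : f ∘ Tuple.sort f = g ∘ Tuple.sort g :=
    List.ofFn_injective <|
      (((Tuple.sort f).ofFn_comp_perm f).trans
        (h.trans ((Tuple.sort g).ofFn_comp_perm g).symm)).eq_of_pairwise'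
        (Tuple.monotone_sort f).sortedLE_ofFn.pairwise
        (Tuple.monotone_sort g).sortedLE_ofFn.pairwise
  refine ⟨(Tuple.sort g).symm.trans (Tuple.sort f), ?_⟩
  ext i
  simpa using congrFun hsort ((Tuple.sort g).symm i)

theorem pauli_y_kronecker_transpose : (pauli 1 ⊗ₖ pauli 1)ᵀ = pauli 1 ⊗ₖ pauli 1 := by
  ext ⟨i, j⟩ ⟨k, l⟩
  fin_cases i <;> fin_cases j <;> fin_cases k <;> fin_cases l <;> simp [pauli]

theorem pauli_y_kronecker_conjTranspose : (pauli 1 ⊗ₖ pauli 1)ᴴ = pauli 1 ⊗ₖ pauli 1 := by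
  ext ⟨i, j⟩ ⟨k, l⟩
  fin_cases i <;> fin_cases j <;> fin_cases k <;> fin_cases l <;> simp [pauli]

open scoped MatrixOrder Matrix.Norms.L2Operator in
/-- A state is `W * Wᴴ` with the columns of `W` orthogonal for the form `σ_y ⊗ σ_y`, the diagonal
values being the square roots of the eigenvalues in the definition of the concurrence. -/
theorem exists_tilde_orthogonal_decomposition (ρ : Matrix (Fin 2 × Fin 2) (Fin 2 × Fin 2) ℂ)
    (hpsd : ρ.PosSemidef) (l : Fin 4 → ℝ)
    (hchar : (ρ * (pauli 1 ⊗ₖ pauli 1) * ρᵀ * (pauli 1 ⊗ₖ pauli 1)).charpoly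
      = ∏ i : Fin 4, (Polynomial.X - Polynomial.C (l i : ℂ))) :
    ∃ W : Matrix (Fin 2 × Fin 2) (Fin 4) ℂ, W * Wᴴ = ρ ∧
      Wᵀ * (pauli 1 ⊗ₖ pauli 1) * W = diagonal fun i => (Real.sqrt (l i) : ℂ) := by
  have hYt := pauli_y_kronecker_transpose
  have hYc := pauli_y_kronecker_conjTranspose
  generalize pauli 1 ⊗ₖ pauli 1 = Y at *
  obtain ⟨V, hV⟩ : ∃ V : Matrix (Fin 2 × Fin 2) (Fin 4) ℂ, V * Vᴴ = ρ := by
    obtain ⟨B, hB⟩ := CStarAlgebra.nonneg_iff_eq_star_mul_self.mp hpsd.nonneg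
    let e : Fin 4 ≃ Fin 2 × Fin 2 := (finProdFinEquiv (m := 2) (n := 2)).symm
    refine ⟨Bᴴ.submatrix id e, ?_⟩
    rw [conjTranspose_submatrix, conjTranspose_conjTranspose, submatrix_mul_equiv, hB,
      submatrix_id_id, star_eq_conjTranspose]
  obtain ⟨U, hU, r, hr, hUV⟩ := Matrix.exists_takagi (Vᵀ * Y * V) (by
    simp only [transpose_mul, transpose_transpose, hYt, Matrix.mul_assoc])
  let W := V * U
  have hW : W * Wᴴ = ρ := by
    calc W * Wᴴ = V * (U * Uᴴ) * Vᴴ := by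
          simp only [W, conjTranspose_mul, Matrix.mul_assoc]
      _ = ρ := by rw [mul_eq_one_comm.1 hU, Matrix.mul_one, hV]
  have hWY : Wᵀ * Y * W = diagonal fun i => (r i : ℂ) := by
    rw [← hUV]
    simp only [W, transpose_mul, Matrix.mul_assoc]
  clear_value W
  have hWY' : Wᴴ * Y * Wᴴᵀ = diagonal fun i => (r i : ℂ) := by
    have := congrArg conjTranspose hWY
    rw [conjTranspose_mul, conjTranspose_mul, hYc, diagonal_conjTranspose, ← Matrix.mul_assoc]
      at this
    simpa [Pi.star_def, show Wᵀᴴ = Wᴴᵀ from rfl] using this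
  have hpoly : ∏ i, (Polynomial.X - Polynomial.C ((r i ^ 2 : ℝ) : ℂ))
      = ∏ i, (Polynomial.X - Polynomial.C (l i : ℂ)) := by
    have h1 : ρ * Y * ρᵀ * Y = W * (Wᴴ * Y * Wᴴᵀ * (Wᵀ * Y)) := by
      rw [← hW, transpose_mul]
      simp only [Matrix.mul_assoc]
    rw [← hchar, h1, charpoly_mul_comm_of_le _ _ (by simp), Matrix.mul_assoc, hWY, hWY',
      diagonal_mul_diagonal, charpoly_diagonal]
    simp [sq]
  have hroots : Finset.univ.val.map (fun i => r i ^ 2) = Finset.univ.val.map l := by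
    have h := congrArg Polynomial.roots hpoly
    have hmap : ∀ f : Fin 4 → ℝ, (∏ i, (Polynomial.X - Polynomial.C (f i : ℂ))).roots
        = (Finset.univ.val.map f).map Complex.ofReal := fun f => by
      rw [Multiset.map_map, ← Polynomial.roots_multiset_prod_X_sub_C
        (Finset.univ.val.map (Complex.ofReal ∘ f)), Multiset.map_map]
      rfl
    rw [hmap, hmap] at h
    exact Multiset.map_injective Complex.ofReal_injective h
  obtain ⟨σ, hσ⟩ := exists_perm_comp_eq_of_map_univ_eq hroots
  refine ⟨W.submatrix id σ, ?_, ?_⟩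
  · rw [conjTranspose_submatrix, submatrix_mul_equiv, hW, submatrix_id_id]
  · have hsqrt : (fun i => (Real.sqrt (l i) : ℂ)) = (fun i => (r i : ℂ)) ∘ σ := by
      funext i
      rw [← hσ]
      simp [Real.sqrt_sq (hr _)]
    rw [hsqrt, ← submatrix_diagonal_equiv, ← hWY]
    ext i j
    simp [Matrix.mul_apply]

/-- Right multiplication by a matrix of phases and then by a real orthogonal matrix does not
change `W * Wᴴ`. -/
theorem mul_conjTranspose_phase_orthogonal {m : Type*} [Fintype m]
    (W : Matrix m (Fin 4) ℂ) (z : Fin 4 → ℂ) (hz : ∀ i, ‖z i‖ = 1)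
    (O : Matrix (Fin 4) (Fin 4) ℝ) (hO : O * Oᵀ = 1) :
    (W * diagonal z * O.map Complex.ofReal) * (W * diagonal z * O.map Complex.ofReal)ᴴ
      = W * Wᴴ := by
  have hO' : O.map Complex.ofReal * (O.map Complex.ofReal)ᴴ = 1 := by
    have h := congrArg (fun M => M.map Complex.ofRealHom) hO
    have e : (O.map Complex.ofReal)ᴴ = Oᵀ.map Complex.ofRealHom := by
      ext i j
      simp
    rw [e]
    rw [Matrix.map_mul, Matrix.map_one _ (map_zero _) (map_one _)] at h
    exact h
  have hz' : diagonal z * (diagonal z)ᴴ = 1 := by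
    rw [diagonal_conjTranspose, diagonal_mul_diagonal, ← diagonal_one]
    congr 1
    funext i
    simp [Complex.mul_conj, Complex.normSq_eq_norm_sq, hz]
  calc _ = W * (diagonal z * (O.map Complex.ofReal * (O.map Complex.ofReal)ᴴ) * (diagonal z)ᴴ)
        * Wᴴ := by simp only [conjTranspose_mul, Matrix.mul_assoc]
    _ = W * Wᴴ := by rw [hO', Matrix.mul_one, hz', Matrix.mul_one]

theorem transpose_mul_mul_phase_orthogonal {m : Type*} [Fintype m]
    (W : Matrix m (Fin 4) ℂ) (Y : Matrix m m ℂ) (r : Fin 4 → ℂ) (hW : Wᵀ * Y * W = diagonal r)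
    (z : Fin 4 → ℂ) (O : Matrix (Fin 4) (Fin 4) ℝ) (k : Fin 4) :
    ((W * diagonal z * O.map Complex.ofReal)ᵀ * Y * (W * diagonal z * O.map Complex.ofReal)) k k
      = ∑ i, z i ^ 2 * r i * (O i k * O i k : ℝ) := by
  have : (W * diagonal z * O.map Complex.ofReal)ᵀ * Y * (W * diagonal z * O.map Complex.ofReal)
      = (O.map Complex.ofReal)ᵀ * (diagonal z * (Wᵀ * Y * W) * diagonal z) *
        O.map Complex.ofReal := by
    simp only [transpose_mul, diagonal_transpose, Matrix.mul_assoc]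
  rw [this, hW, diagonal_mul_diagonal, diagonal_mul_diagonal, Matrix.mul_apply]
  refine Finset.sum_congr rfl fun i _ => ?_
  rw [mul_diagonal]
  simp
  ring

/-- **Wootters decomposition**: a state has a pure-state decomposition in which the concurrence
of every term is the concurrence of the state. -/
theorem exists_wootters_decomposition (ρ : Matrix (Fin 2 × Fin 2) (Fin 2 × Fin 2) ℂ)
    (hpsd : ρ.PosSemidef) (htr : ρ.trace = 1) (l : Fin 4 → ℝ) (hord : Antitone l)
    (hchar : (ρ * (pauli 1 ⊗ₖ pauli 1) * ρᵀ * (pauli 1 ⊗ₖ pauli 1)).charpoly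
      = ∏ i : Fin 4, (Polynomial.X - Polynomial.C (l i : ℂ))) :
    ∃ Z : Matrix (Fin 2 × Fin 2) (Fin 4) ℂ, Z * Zᴴ = ρ ∧ ∀ k,
      ‖(Zᵀ * (pauli 1 ⊗ₖ pauli 1) * Z) k k‖
        = max 0 (Real.sqrt (l 0) - Real.sqrt (l 1) - Real.sqrt (l 2) - Real.sqrt (l 3))
          * ((Zᴴ * Z) k k).re := by
  obtain ⟨W, hW, hWY⟩ := exists_tilde_orthogonal_decomposition ρ hpsd l hchar
  have hs : ∀ {i j}, i ≤ j → Real.sqrt (l j) ≤ Real.sqrt (l i) := fun h =>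
    Real.sqrt_le_sqrt (hord h)
  rcases le_total (Real.sqrt (l 0) - Real.sqrt (l 1) - Real.sqrt (l 2) - Real.sqrt (l 3)) 0
    with h | h
  · rw [max_eq_left h]
    obtain ⟨u, hu, hsum⟩ := exists_unit_sum_mul_eq_zero (fun i => Real.sqrt (l i))
      (Real.sqrt_nonneg _) (hs (by decide)) (hs (by decide)) (hs (by decide)) (by linarith)
    choose z hz using fun i => IsAlgClosed.exists_pow_nat_eq (u i) two_pos
    have hz1 : ∀ i, ‖z i‖ = 1 := fun i => by
      have := hu i
      rw [← hz, norm_pow] at this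
      exact (pow_eq_one_iff_of_nonneg (norm_nonneg _) two_ne_zero).1 this
    refine ⟨_, (mul_conjTranspose_phase_orthogonal W z hz1 hadamardFour
      hadamardFour_mul_transpose).trans hW, fun k => ?_⟩
    rw [transpose_mul_mul_phase_orthogonal W _ _ hWY]
    simp_rw [hadamardFour_sq, hz]
    rw [← Finset.sum_mul, hsum]
    simp
  · rw [max_eq_right h]
    let z : Fin 4 → ℂ := ![1, Complex.I, Complex.I, Complex.I]
    let r : Fin 4 → ℝ := ![Real.sqrt (l 0), -Real.sqrt (l 1), -Real.sqrt (l 2), -Real.sqrt (l 3)]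
    have hz1 : ∀ i, ‖z i‖ = 1 := fun i => by fin_cases i <;> simp [z]
    have hzr : ∀ i, z i ^ 2 * (Real.sqrt (l i) : ℂ) = (r i : ℂ) := fun i => by
      fin_cases i <;> simp [z, r]
    set c := Real.sqrt (l 0) - Real.sqrt (l 1) - Real.sqrt (l 2) - Real.sqrt (l 3) with hc
    have hrsum : ∑ i, r i = c := by
      simp [Fin.sum_univ_four, r, hc]
      ring
    let G := (W * diagonal z)ᴴ * (W * diagonal z)
    have hG : G.IsHermitian := isHermitian_conjTranspose_mul_self _
    have hGtr : G.trace = 1 := by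
      have h1 := mul_conjTranspose_phase_orthogonal W z hz1 1 (by simp)
      rw [Matrix.map_one _ Complex.ofReal_zero Complex.ofReal_one, Matrix.mul_one, hW] at h1
      rw [trace_mul_comm, h1, htr]
    let N : Matrix (Fin 4) (Fin 4) ℝ := G.map Complex.re
    have hS : (diagonal r - c • N).IsHermitian := by
      refine IsHermitian.sub (isHermitian_diagonal r) ?_
      ext i j
      have := congrArg Complex.re (congrFun (congrFun hG i) j)
      simpa [N] using Or.inl this
    have hStr : (diagonal r - c • N).trace = 0 := by
      have hN : N.trace = 1 := by
        have := congrArg Complex.re hGtr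
        simpa [Matrix.trace, N] using this
      rw [trace_sub, trace_smul, hN, trace_diagonal, hrsum]
      simp
    obtain ⟨O, hO, hdiag⟩ := exists_orthogonal_diag_eq_zero _ hS hStr
    refine ⟨_, (mul_conjTranspose_phase_orthogonal W z hz1 O hO).trans hW, fun k => ?_⟩
    have hnorm : (((W * diagonal z * O.map Complex.ofReal)ᴴ
        * (W * diagonal z * O.map Complex.ofReal)) k k).re = (Oᵀ * N * O) k k := by
      have e : (W * diagonal z * O.map Complex.ofReal)ᴴ * (W * diagonal z * O.map Complex.ofReal)
          = (O.map Complex.ofReal)ᴴ * G * O.map Complex.ofReal := by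
        simp only [G, conjTranspose_mul, Matrix.mul_assoc]
      rw [e]
      simp [Matrix.mul_apply, N]
    have hpos : 0 ≤ (Oᵀ * N * O) k k := by
      rw [← hnorm]
      simp only [Matrix.mul_apply (M := (_)ᴴ), conjTranspose_apply, Complex.re_sum]
      refine Finset.sum_nonneg fun p _ => ?_
      rw [Complex.star_def, ← Complex.normSq_eq_conj_mul_self, Complex.ofReal_re]
      exact Complex.normSq_nonneg _
    have hval : ∑ i, r i * (O i k * O i k) = c * (Oᵀ * N * O) k k := by
      have h1 : (Oᵀ * diagonal r * O) k k = ∑ i, r i * (O i k * O i k) := by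
        rw [Matrix.mul_apply]
        refine Finset.sum_congr rfl fun i _ => ?_
        rw [mul_diagonal, transpose_apply]
        ring
      have h2 := hdiag k
      rw [Matrix.mul_sub, Matrix.sub_mul, Matrix.mul_smul, Matrix.smul_mul, Matrix.sub_apply, h1,
        Matrix.smul_apply, smul_eq_mul] at h2
      linarith
    rw [transpose_mul_mul_phase_orthogonal W _ _ hWY, hnorm, ← hval]
    simp_rw [hzr, ← Complex.ofReal_mul]
    rw [← Complex.ofReal_sum, hval, Complex.norm_real, Real.norm_of_nonneg (mul_nonneg h hpos)]

/-- for any two-qubit density matrix ρ with Wootters concurrence C(ρ),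
the maximal CHSH expectation satisfies β(ρ) ≤ √(1 + C(ρ)²). -/
theorem chsh_le_of_concurrence (ρ : Matrix (Fin 2 × Fin 2) (Fin 2 × Fin 2) ℂ)
    (hpsd : ρ.PosSemidef) (htr : ρ.trace = 1)
    (l : Fin 4 → ℝ) (hord : Antitone l) (hpos : ∀ i, 0 ≤ l i)
    (hchar : (ρ * (pauli 1 ⊗ₖ pauli 1) * ρᵀ * (pauli 1 ⊗ₖ pauli 1)).charpoly
      = ∏ i : Fin 4, (Polynomial.X - Polynomial.C (l i : ℂ)))
    (Cc : ℝ)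
    (hC : Cc = max 0 (Real.sqrt (l 0) - Real.sqrt (l 1) - Real.sqrt (l 2) - Real.sqrt (l 3))) :
    ∀ t ∈ betaSet ρ, t ≤ Real.sqrt (1 + Cc ^ 2) := by
  rintro t ⟨a, b, c, d, ha, hb, hc, hd, rfl⟩
  obtain ⟨Z, hZ, hZY⟩ := exists_wootters_decomposition ρ hpsd htr l hord hchar
  rw [← hC] at hZY
  let p : Fin 4 → ℝ := fun k => ((Zᴴ * Z) k k).re
  have hp : ∀ k, p k = ∑ i, Complex.normSq (Zᵀ k i) := fun k => by
    simp only [p, Matrix.mul_apply, conjTranspose_apply, Complex.re_sum, Complex.star_def,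
      ← Complex.normSq_eq_conj_mul_self, Complex.ofReal_re, transpose_apply]
  have hp0 : ∀ k, 0 ≤ p k := fun k => by
    rw [hp]
    exact Finset.sum_nonneg fun i _ => Complex.normSq_nonneg _
  have hpsum : ∑ k, p k = 1 := by
    have h : (Zᴴ * Z).trace = 1 := by rw [trace_mul_comm, hZ, htr]
    simpa [Matrix.trace, p] using congrArg Complex.re h
  have hexp : (ρ * bellOp a b c d).trace
      = ∑ k, star (Zᵀ k) ⬝ᵥ bellOp a b c d *ᵥ Zᵀ k := by
    rw [← hZ, Matrix.mul_assoc, trace_mul_comm, Matrix.mul_assoc]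
    rfl
  have hterm : ∀ k, (star (Zᵀ k) ⬝ᵥ bellOp a b c d *ᵥ Zᵀ k).re
      ≤ p k * Real.sqrt (1 + Cc ^ 2) := fun k => by
    refine (expectation_bellOp_le (Zᵀ k) a b c d ha hb hc hd).trans_eq ?_
    have hY : Zᵀ k ⬝ᵥ (pauli 1 ⊗ₖ pauli 1) *ᵥ Zᵀ k
        = (Zᵀ * (pauli 1 ⊗ₖ pauli 1) * Z) k k := by
      rw [Matrix.mul_assoc]
      rfl
    rw [← hp, hY, hZY]
    change Real.sqrt (p k ^ 2 + (Cc * p k) ^ 2) = _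
    rw [show p k ^ 2 + (Cc * p k) ^ 2 = p k ^ 2 * (1 + Cc ^ 2) by ring,
      Real.sqrt_mul (sq_nonneg _), Real.sqrt_sq (hp0 k)]
  rw [hexp, Complex.re_sum]
  calc _ ≤ ∑ k, p k * Real.sqrt (1 + Cc ^ 2) := Finset.sum_le_sum fun k _ => hterm k
    _ = Real.sqrt (1 + Cc ^ 2) := by rw [← Finset.sum_mul, hpsum, one_mul]
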